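/- Let n ≥ 1, let f : ℂⁿ → ℂ be entire, and let a and b be two distinct complex numbers. Suppose f(z) ≠ a for all z ∈ ℂⁿ, and that every point α ∈ ℂⁿ with f(α) = b is a zero of f − b of multiplicity at least two, i.e., f(α) = b implies ∂f/∂z_j(α) = 0 for all j = 1,…,n. Then f is constant. -/

import Mathlib

open Filter Topology Metric

/-- The partial derivative ∂f/∂z_i of f : ℂⁿ → ℂ at z. -/
noncomputable def pd {n : ℕ} (f : EuclideanSpace ℂ (Fin n) → ℂ) (i : Fin n)
    (z : EuclideanSpace ℂ (Fin n)) : ℂ :=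
  fderiv ℂ f z (EuclideanSpace.single i 1)

open ComplexConjugate in
lemma aux_cayley (h : ℂ → ℂ) (hd : Differentiable ℂ h) (c : ℂ) (r : ℝ) (hr : 0 < r)
    (hpos : ∀ z ∈ ball c r, 0 < (h z).re) :
    ‖deriv h c‖ ≤ 2 * (h c).re / r ∧
    ∀ z ∈ ball c r, (h c).re * (1 - dist z c / r) ≤ (h z).re * (1 + dist z c / r) := by
  have hc : 0 < (h c).re := hpos c (mem_ball_self hr)
  set φ : ℂ → ℂ := fun z => (h z - h c) / (h z + conj (h c)) with hφ
  have hden : ∀ z ∈ ball c r, h z + conj (h c) ≠ 0 := by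
    intro z hz h0
    have := congrArg Complex.re h0
    simp at this
    have := hpos z hz
    linarith
  have hφd : DifferentiableOn ℂ φ (ball c r) := by
    apply DifferentiableOn.div
    · exact (hd.sub_const _).differentiableOn
    · exact (hd.add_const _).differentiableOn
    · exact hden
  have hφc : φ c = 0 := by simp [hφ]
  have hsq : ∀ w : ℂ, ‖w‖ ^ 2 = w.re ^ 2 + w.im ^ 2 := by
    intro w; rw [Complex.sq_norm, Complex.normSq_apply]; ring
  have hm : Set.MapsTo φ (ball c r) (closedBall (φ c) 1) := by
    intro z hz
    rw [hφc, mem_closedBall_zero_iff, hφ]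
    simp only [norm_div]
    rw [div_le_one (norm_pos_iff.2 (hden z hz))]
    apply le_of_sq_le_sq _ (norm_nonneg _)
    rw [hsq, hsq]
    have := hpos z hz
    simp
    nlinarith [mul_pos this hc]
  constructor
  · have h1 := Complex.norm_deriv_le_div_of_mapsTo_ball hφd hm hr
    have h2 : HasDerivAt φ (deriv h c / (h c + conj (h c))) c := by
      have hh := (hd c).hasDerivAt
      have := (hh.sub_const (h c)).div (hh.add_const (conj (h c))) (hden c (mem_ball_self hr))
      refine HasDerivAt.congr_deriv this ?_
      have := hden c (mem_ball_self hr)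
      field_simp
      simp
    rw [h2.deriv, Complex.add_conj, norm_div, Complex.norm_real, Real.norm_eq_abs,
      abs_of_pos (by positivity), div_le_iff₀ (by positivity)] at h1
    calc _ ≤ _ := h1
      _ = _ := by ring
  · intro z hz
    have h1 := Complex.dist_le_div_mul_dist_of_mapsTo_ball hφd hm hz
    rw [hφc, dist_zero_right, hφ] at h1
    simp only [norm_div] at h1
    rw [div_le_iff₀ (norm_pos_iff.2 (hden z hz)), one_div_mul_eq_div] at h1
    set t := dist z c / r with ht
    have ht0 : 0 ≤ t := by positivity
    have ht1 : t < 1 := by rw [ht, div_lt_one hr]; exact hz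
    have hz' := hpos z hz
    have h3 : ‖h z - h c‖ ^ 2 ≤ t ^ 2 * ‖h z + conj (h c)‖ ^ 2 := by
      rw [← mul_pow]; gcongr
    rw [hsq, hsq] at h3
    simp at h3
    have h4 : ((h z).re - (h c).re) ^ 2 ≤ (t * ((h z).re + (h c).re)) ^ 2 := by
      have : t ^ 2 ≤ 1 := by nlinarith
      nlinarith [sq_nonneg ((h z).im - (h c).im)]
    have h5 := abs_le_of_sq_le_sq' h4 (by positivity)
    linarith [h5.1]

lemma aux_hopf (h : ℂ → ℂ) (hd : Differentiable ℂ h) (c p : ℂ) (hcp : 0 < dist c p)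
    (hp : (h p).re ≤ 1)
    (hpos : ∀ z ∈ ball c (dist c p), 1 < (h z).re) :
    (h c).re - 1 ≤ 2 * dist c p * ‖deriv h p‖ := by
  have hd1 : Differentiable ℂ (fun z => h z - 1) := hd.sub_const 1
  have hk := (aux_cayley (fun z => h z - 1) hd1 c (dist c p) hcp
    (fun z hz => by simpa using hpos z hz)).2
  set x := (h c).re - 1 with hx
  have hx0 : 0 < x := by have := hpos c (mem_ball_self hcp); linarith
  have hl : HasDerivAt (fun s : ℝ => h (p + s * (c - p))) (deriv h p * (c - p)) 0 := by
    have h1 : HasDerivAt (fun s : ℝ => p + (s : ℂ) * (c - p)) (c - p) 0 := by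
      have := ((Complex.ofRealCLM.hasDerivAt (x := (0:ℝ))).mul_const (c - p)).const_add p
      simpa using this
    have h2 : HasDerivAt h (deriv h p) (p + ((0 : ℝ) : ℂ) * (c - p)) := by
      simpa using (hd p).hasDerivAt
    exact h2.comp (0 : ℝ) h1
  have hl2 := hasDerivWithinAt_iff_tendsto_slope.1 (hl.hasDerivWithinAt (s := Set.Ioi 0))
  have hl3 := hl2.norm
  have hev : ∀ᶠ s in 𝓝[Set.Ioi 0 \ {0}] (0 : ℝ), x / 2 ≤ ‖slope (fun s : ℝ => h (p + s * (c - p))) 0 s‖ := by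
    have : ∀ᶠ s in 𝓝[Set.Ioi 0 \ {0}] (0 : ℝ), s < 1 :=
      nhdsWithin_le_nhds (Iio_mem_nhds one_pos)
    filter_upwards [this, self_mem_nhdsWithin] with s hs1 hs0
    have hs0 : 0 < s := hs0.1
    have hdist : dist (p + s * (c - p)) c = (1 - s) * dist c p := by
      rw [dist_eq_norm, dist_eq_norm]
      have : p + s * (c - p) - c = - (((1 - s : ℝ) : ℂ) * (c - p)) := by push_cast; ring
      rw [this, norm_neg, norm_mul, Complex.norm_real, Real.norm_eq_abs, abs_of_pos (by linarith)]
    have hmem : p + s * (c - p) ∈ ball c (dist c p) := by rw [mem_ball, hdist]; nlinarith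
    have h1 := hk (p + s * (c - p)) hmem
    have hy0 : 0 < (h (p + s * (c - p))).re - 1 := by linarith [hpos _ hmem]
    rw [hdist, mul_div_assoc, div_self hcp.ne'] at h1
    simp at h1
    rw [← hx] at h1
    rw [slope_def_module, norm_smul]
    simp
    rw [abs_of_pos hs0, inv_mul_eq_div, le_div_iff₀ hs0]
    have h2 := Complex.re_le_norm (h (p + s * (c - p)) - h p)
    simp at h2
    have h3 : x * s / 2 ≤ (h (p + s * (c - p))).re - 1 := by
      set y := (h (p + s * (c - p))).re - 1
      nlinarith [mul_pos hy0 hs0]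
    linarith
  have hne : (𝓝[Set.Ioi 0 \ {0}] (0 : ℝ)).NeBot := by
    have : Set.Ioi (0:ℝ) \ {0} = Set.Ioi 0 := by
      ext; simp
    rw [this]; infer_instance
  have := ge_of_tendsto hl3 hev
  rw [norm_mul, ← dist_eq_norm] at this
  linarith

lemma aux_cosh_one : Real.cosh 1 ≤ 2 := by
  rw [Real.cosh_eq]
  have := Real.exp_one_lt_d9
  have : Real.exp (-1) ≤ 1 := Real.exp_le_one_iff.2 (by norm_num)
  linarith

lemma aux_bound (h : ℂ → ℂ) (hd : Differentiable ℂ h) (c p : ℂ) (hc : 1 < (h c).re)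
    (hp : (h p).re ≤ 1)
    (hb : ∀ z ∈ closedBall c (dist c p), ‖deriv h z‖ ≤ 2 * Real.cosh (h z).re) :
    ‖deriv h c‖ ≤ 16 := by
  have hcont : Continuous fun z => (h z).re := Complex.continuous_re.comp hd.continuous
  have hcl : IsClosed {z | (h z).re ≤ 1} := isClosed_le hcont continuous_const
  obtain ⟨q, hq, hqd⟩ := hcl.exists_infDist_eq_dist ⟨p, hp⟩ c
  have hle : dist c q ≤ dist c p := by
    rw [← hqd]; exact infDist_le_dist_of_mem hp
  have hpos : ∀ z ∈ ball c (dist c q), 1 < (h z).re := by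
    intro z hz
    by_contra hcon
    have : infDist c {z | (h z).re ≤ 1} ≤ dist c z := infDist_le_dist_of_mem (not_lt.1 hcon)
    rw [mem_ball, dist_comm] at hz
    linarith
  have hcq : 0 < dist c q := by
    rw [dist_pos]; rintro rfl; exact absurd hq (not_le.2 hc)
  have hq1 : (h q).re = 1 := by
    apply le_antisymm hq
    have hcl2 : IsClosed {z | 1 ≤ (h z).re} := isClosed_le continuous_const hcont
    have : closure (ball c (dist c q)) ⊆ {z | 1 ≤ (h z).re} :=
      hcl2.closure_subset_iff.2 (fun z hz => (hpos z hz).le)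
    apply this
    rw [closure_ball _ hcq.ne']
    rw [mem_closedBall, dist_comm]
  have h1 := aux_hopf h hd c q hcq hq hpos
  have h2 := hb q (by rw [mem_closedBall, dist_comm]; exact hle)
  rw [hq1] at h2
  have h3 := aux_cosh_one
  have h4 := (aux_cayley (fun z => h z - 1) (hd.sub_const 1) c (dist c q) hcq
    (fun z hz => by simpa using hpos z hz)).1
  simp at h4
  have h5 : (h c).re - 1 ≤ 8 * dist c q := by nlinarith
  refine h4.trans ?_
  rw [div_le_iff₀ hcq]
  linarith

lemma aux_bound' (h : ℂ → ℂ) (hd : Differentiable ℂ h) (c p : ℂ)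
    (hp : |(h p).re| ≤ 1)
    (hb : ∀ z ∈ closedBall c (dist c p), ‖deriv h z‖ ≤ 2 * Real.cosh (h z).re) :
    ‖deriv h c‖ ≤ 16 := by
  rcases lt_or_ge 1 (h c).re with h1 | h1
  · exact aux_bound h hd c p h1 (abs_le.1 hp).2 hb
  rcases lt_or_ge (h c).re (-1) with h2 | h2
  · have := aux_bound (fun z => - h z) hd.neg c p (by simp; linarith)
      (by simp; linarith [(abs_le.1 hp).1]) (fun z hz => by simpa using hb z hz)
    simpa using this
  · have := hb c (mem_closedBall_self dist_nonneg)
    have h3 : Real.cosh (h c).re ≤ Real.cosh 1 := by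
      rw [Real.cosh_le_cosh, abs_one]; exact abs_le.2 ⟨h2, h1⟩
    linarith [aux_cosh_one]

lemma aux_lt_cosh (x : ℝ) : x < Real.cosh x := by
  rcases le_or_gt x 0 with h | h
  · linarith [Real.cosh_pos x]
  · have h1 := Real.quadratic_le_exp_of_nonneg h.le
    have h2 := Real.add_one_lt_exp (neg_ne_zero.2 h.ne')
    rw [Real.cosh_eq]
    nlinarith [sq_nonneg (x - 1), sq_nonneg (x-2)]

lemma aux_near (h : ℂ → ℂ) (hd : Differentiable ℂ h)
    (hb : ∀ z ∈ closedBall (0 : ℂ) 8, ‖deriv h z‖ ≤ 2 * Real.cosh (h z).re)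
    (h0 : Real.cosh (h 0).re ≤ ‖deriv h 0‖) :
    ∃ p : ℂ, ‖p‖ ≤ 8 ∧ |(h p).re| ≤ 1 := by
  by_contra! hcon
  have hcont : Continuous fun z => (h z).re := Complex.continuous_re.comp hd.continuous
  have hne : ∀ p ∈ ball (0:ℂ) 8, (h p).re ≠ 0 := by
    intro p hp h1
    have := hcon p (by simpa using (mem_ball.1 hp).le)
    rw [h1] at this; simp at this; linarith
  have hpre : IsPreconnected (ball (0:ℂ) 8) := (convex_ball _ _).isPreconnected
  have key : ∀ k : ℂ → ℂ, Differentiable ℂ k → (∀ p ∈ ball (0:ℂ) 8, (k p).re ≠ 0) →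
      0 < (k 0).re → Real.cosh (k 0).re ≤ ‖deriv k 0‖ → False := by
    intro k hkd hk hk0 hk1
    have hkc : Continuous fun z => (k z).re := Complex.continuous_re.comp hkd.continuous
    have hpos : ∀ p ∈ ball (0:ℂ) 8, 0 < (k p).re := by
      intro p hp
      by_contra hn
      obtain ⟨q, hq, hq0⟩ := hpre.intermediate_value hp (mem_ball_self (by norm_num))
        hkc.continuousOn ⟨not_lt.1 hn, hk0.le⟩
      exact hk q hq hq0
    have := (aux_cayley k hkd 0 8 (by norm_num) hpos).1
    have := aux_lt_cosh (k 0).re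
    linarith
  rcases lt_or_gt_of_ne (hne 0 (mem_ball_self (by norm_num))) with h1 | h1
  · exact key (fun z => - h z) hd.neg (by simpa using hne) (by simpa using h1) (by simpa using h0)
  · exact key h hd hne h1 h0

lemma aux_main (h : ℂ → ℂ) (hd : Differentiable ℂ h)
    (hb : ∀ z ∈ closedBall (0 : ℂ) 20000, ‖deriv h z‖ ≤ 2 * Real.cosh (h z).re)
    (h0 : Real.cosh (h 0).re ≤ ‖deriv h 0‖) :
    ∃ (z : ℂ) (k : ℤ), h z = k * (2 * Real.pi * Complex.I) ∧ deriv h z ≠ 0 := by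
  obtain ⟨p, hp8, hp⟩ := aux_near h hd
    (fun z hz => hb z (closedBall_subset_closedBall (by norm_num) hz)) h0
  have hbd : ∀ z ∈ ball (0:ℂ) 8000, ‖deriv h z‖ ≤ 16 := by
    intro z hz
    apply aux_bound' h hd z p hp
    intro w hw
    apply hb
    simp only [mem_closedBall, mem_ball, dist_eq_norm, sub_zero] at *
    have h1 := norm_sub_le z p
    have h2 : ‖w‖ ≤ ‖w - z‖ + ‖z‖ := by simpa using norm_add_le (w - z) z
    linarith
  have hd' : Differentiable ℂ (deriv h) :=
    fun z => (hd.analyticAt z).deriv.differentiableAt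
  have hm : Set.MapsTo (deriv h) (ball 0 8000) (closedBall (deriv h 0) 32) := by
    intro z hz
    rw [mem_closedBall, dist_eq_norm]
    have h1 := norm_sub_le (deriv h z) (deriv h 0)
    have h2 := hbd z hz
    have h3 := hbd 0 (mem_ball_self (by norm_num))
    linarith
  have hclose : ∀ z ∈ closedBall (0:ℂ) 56, ‖deriv h z - deriv h 0‖ ≤ 1 / 4 := by
    intro z hz
    have h1 := Complex.dist_le_div_mul_dist_of_mapsTo_ball hd'.differentiableOn hm
      (closedBall_subset_ball (by norm_num) hz)
    rw [dist_eq_norm] at h1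
    rw [mem_closedBall] at hz
    linarith
  have hd0 : 1 ≤ ‖deriv h 0‖ := (Real.one_le_cosh _).trans h0
  have hx : |(h 0).re| ≤ 16 := by
    have h1 := aux_lt_cosh |(h 0).re|
    rw [Real.cosh_abs] at h1
    have h3 := hbd 0 (mem_ball_self (by norm_num))
    linarith
  have hlin : ∀ z ∈ closedBall (0:ℂ) 56, ‖(h z - deriv h 0 * z) - h 0‖ ≤ 1 / 4 * ‖z‖ := by
    intro z hz
    have := (convex_closedBall (0:ℂ) 56).norm_image_sub_le_of_norm_hasDerivWithin_le
      (f := fun z => h z - deriv h 0 * z) (f' := fun z => deriv h z - deriv h 0) (C := 1 / 4)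
      (x := 0) (y := z)
      (fun w hw => by
        have h1 := (hd w).hasDerivAt.sub ((hasDerivAt_id w).const_mul (deriv h 0))
        refine HasDerivAt.hasDerivWithinAt (HasDerivAt.congr_deriv h1 ?_)
        simp) hclose (mem_closedBall_self (by norm_num)) hz
    simpa using this
  have hlow : ∀ z ∈ closedBall (0:ℂ) 56, 3 / 4 * ‖z‖ ≤ ‖h z - h 0‖ := by
    intro z hz
    have h1 := hlin z hz
    have h2 := norm_sub_le (h z - h 0) ((h z - deriv h 0 * z) - h 0)
    have h3 : (h z - h 0) - ((h z - deriv h 0 * z) - h 0) = deriv h 0 * z := by ring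
    rw [h3, norm_mul] at h2
    nlinarith [norm_nonneg z]
  have hsub := DiffContOnCl.ball_subset_image_closedBall (f := h) (z₀ := 0) (r := 56) (ε := 42)
    hd.diffContOnCl (by norm_num)
    (fun z hz => by
      have := hlow z (sphere_subset_closedBall hz)
      rw [mem_sphere_zero_iff_norm] at hz
      rw [hz] at this; linarith)
    (by
      have hfr : ∃ᶠ z in 𝓝[≠] (0:ℂ), True := by
        rw [Filter.frequently_true_iff_neBot]; infer_instance
      have hev : ∀ᶠ z in 𝓝[≠] (0:ℂ), h z ≠ h 0 :=
        HasDerivAt.eventually_ne (hd 0).hasDerivAt (norm_pos_iff.1 (by linarith))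
      exact (hev.frequently).filter_mono nhdsWithin_le_nhds)
  set k : ℤ := round ((h 0).im / (2 * Real.pi)) with hk
  have hkr := abs_sub_round ((h 0).im / (2 * Real.pi))
  have hpi := Real.pi_pos
  have hpi4 := Real.pi_lt_d2
  have him : |(h 0).im - k * (2 * Real.pi)| ≤ Real.pi := by
    have : (h 0).im - k * (2 * Real.pi) = ((h 0).im / (2 * Real.pi) - k) * (2 * Real.pi) := by
      field_simp
    rw [this, abs_mul, abs_of_pos (by positivity : 0 < 2 * Real.pi)]
    nlinarith
  have hmem : (k * (2 * Real.pi * Complex.I) : ℂ) ∈ ball (h 0) (42 / 2) := by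
    rw [mem_ball, dist_comm, dist_eq_norm]
    have h1 := Complex.norm_le_abs_re_add_abs_im (h 0 - k * (2 * Real.pi * Complex.I))
    simp at h1
    linarith
  obtain ⟨z, hz, hzk⟩ := hsub hmem
  refine ⟨z, k, hzk, fun hz0 => ?_⟩
  have := hclose z hz
  rw [hz0, zero_sub, norm_neg] at this
  linarith

lemma aux_entire (h : ℂ → ℂ) (hd : Differentiable ℂ h)
    (hram : ∀ (z : ℂ) (k : ℤ), h z = k * (2 * Real.pi * Complex.I) → deriv h z = 0) :
    ∀ z, deriv h z = 0 := by
  intro a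
  by_contra ha
  have hcosh : ∀ z, 0 < Real.cosh (h z).re := fun z => Real.cosh_pos _
  have hd' : Continuous (deriv h) :=
    (show Differentiable ℂ (deriv h) from
      fun z => (hd.analyticAt z).deriv.differentiableAt).continuous
  have hcont : Continuous fun z => (h z).re := Complex.continuous_re.comp hd.continuous
  set s : ℂ → ℝ := fun z => ‖deriv h z‖ / Real.cosh (h z).re with hs
  have hsc : Continuous s := hd'.norm.div (Real.continuous_cosh.comp hcont) (fun z => (hcosh z).ne')
  have hs0 : ∀ z, 0 ≤ s z := fun z => div_nonneg (norm_nonneg _) (hcosh z).le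
  have hsa : 0 < s a := div_pos (norm_pos_iff.2 ha) (hcosh a)
  set R : ℝ := 40000 / s a with hR
  have hRpos : 0 < R := by positivity
  obtain ⟨c, hc, hmax⟩ := (isCompact_closedBall a R).exists_isMaxOn
    ⟨a, mem_closedBall_self hRpos.le⟩
    (f := fun z => (R - dist z a) * s z) (by fun_prop)
  have hm := hmax (mem_closedBall_self hRpos.le)
  simp only [Set.mem_setOf_eq, dist_self, sub_zero] at hm
  rw [hR, div_mul_cancel₀ _ hsa.ne', ← hR] at hm
  rw [mem_closedBall] at hc
  set d := R - dist c a with hdd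
  have hdpos : 0 < d := by
    rcases (show 0 ≤ d by linarith).eq_or_lt with h1 | h1
    · rw [← h1] at hm; norm_num at hm
    · exact h1
  have hscp : 0 < s c := by
    rcases (hs0 c).eq_or_lt with h1 | h1
    · rw [← h1] at hm; norm_num at hm
    · exact h1
  have hnear : ∀ z, dist z c ≤ d / 2 → s z ≤ 2 * s c := by
    intro z hz
    have h1 := dist_triangle z c a
    have h2 := hmax (show z ∈ closedBall a R by rw [mem_closedBall]; linarith)
    simp only [Set.mem_setOf_eq] at h2
    have h3 : d / 2 * s z ≤ (R - dist z a) * s z := by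
      apply mul_le_mul_of_nonneg_right _ (hs0 z); linarith
    have h4 : d * s z ≤ d * (2 * s c) := by linarith
    exact le_of_mul_le_mul_left h4 hdpos
  set ρ : ℝ := 1 / s c with hρ
  have hρpos : 0 < ρ := by positivity
  set k : ℂ → ℂ := fun z => h (c + ρ * z) with hkdef
  have hkder : ∀ z, HasDerivAt k (deriv h (c + ρ * z) * ρ) z := by
    intro z
    have h1 : HasDerivAt (fun z : ℂ => c + ρ * z) (ρ : ℂ) z := by
      simpa using ((hasDerivAt_id z).const_mul (ρ : ℂ)).const_add c
    exact (hd _).hasDerivAt.comp z h1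
  have hknorm : ∀ z, ‖deriv k z‖ = s (c + ρ * z) * ρ * Real.cosh (k z).re := by
    intro z
    rw [(hkder z).deriv, norm_mul, Complex.norm_real, Real.norm_eq_abs, abs_of_pos hρpos]
    have := hcosh (c + ρ * z)
    simp only [hs, hkdef]
    field_simp
  obtain ⟨z, n, hz, hz'⟩ := aux_main k (fun z => (hkder z).differentiableAt)
    (by
      intro z hz
      rw [hknorm]
      have h1 : s (c + ρ * z) ≤ 2 * s c := by
        apply hnear
        rw [mem_closedBall_zero_iff] at hz
        rw [dist_eq_norm, add_sub_cancel_left, norm_mul, Complex.norm_real, Real.norm_eq_abs,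
          abs_of_pos hρpos, hρ, one_div_mul_eq_div, div_le_iff₀ hscp]
        linarith
      have h2 : s (c + ρ * z) * ρ ≤ 2 := by
        rw [hρ, mul_one_div, div_le_iff₀ hscp]; exact h1
      exact mul_le_mul_of_nonneg_right h2 (Real.cosh_pos _).le)
    (by
      rw [hknorm]
      simp [hρ, hscp.ne'])
  apply hz'
  rw [(hkder z).deriv, hram _ n hz, zero_mul]

lemma aux_one (g : ℂ → ℂ) (hg : Differentiable ℂ g) (a b : ℂ) (hab : a ≠ b)
    (ha : ∀ z, g z ≠ a) (hb : ∀ z, g z = b → deriv g z = 0) : ∀ z w, g z = g w := by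
  have hba : b - a ≠ 0 := sub_ne_zero.2 hab.symm
  have hga : ∀ z, g z - a ≠ 0 := fun z => sub_ne_zero.2 (ha z)
  have hd' : Differentiable ℂ (deriv g) :=
    fun z => (hg.analyticAt z).deriv.differentiableAt
  have hq : Differentiable ℂ (fun z => deriv g z / (g z - a)) :=
    hd'.div (hg.sub_const a) hga
  obtain ⟨H, hH⟩ := hq.isExactOn_univ
  have hH' : ∀ z, HasDerivAt H (deriv g z / (g z - a)) z := fun z => hH z (Set.mem_univ z)
  have hconst : ∀ z, (g z - a) * Complex.exp (-H z) = (g 0 - a) * Complex.exp (-H 0) := by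
    have hder : ∀ z, HasDerivAt (fun z => (g z - a) * Complex.exp (-H z)) 0 z := by
      intro z
      have := ((hg z).hasDerivAt.sub_const a).mul (hH' z).neg.cexp
      refine HasDerivAt.congr_deriv this ?_
      have := hga z
      field_simp
      ring
    intro z
    exact is_const_of_deriv_eq_zero (fun z => (hder z).differentiableAt) (fun z => (hder z).deriv) z 0
  set C := (g 0 - a) * Complex.exp (-H 0) / (b - a) with hC
  have hC0 : C ≠ 0 := div_ne_zero (mul_ne_zero (hga 0) (Complex.exp_ne_zero _)) hba
  set h : ℂ → ℂ := fun z => H z + Complex.log C with hh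
  have hexp : ∀ z, g z - a = (b - a) * Complex.exp (h z) := by
    intro z
    rw [hh]
    simp only
    rw [Complex.exp_add, Complex.exp_log hC0, hC, ← hconst z, Complex.exp_neg]
    have := Complex.exp_ne_zero (H z)
    field_simp
  have hhd : ∀ z, HasDerivAt h (deriv g z / (g z - a)) z := fun z => (hH' z).add_const _
  have hz := aux_entire h (fun z => (hhd z).differentiableAt) (by
    intro z k hk
    rw [(hhd z).deriv, hb z, zero_div]
    have h1 := hexp z
    rw [hk, Complex.exp_int_mul_two_pi_mul_I, mul_one] at h1
    exact sub_left_injective h1)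
  intro z w
  refine is_const_of_deriv_eq_zero hg (fun z => ?_) z w
  have := hz z
  rw [(hhd z).deriv, div_eq_zero_iff] at this
  exact this.resolve_right (hga z)

theorem stmt_7 {n : ℕ} (hn : 1 ≤ n) (a b : ℂ) (hab : a ≠ b)
    (f : EuclideanSpace ℂ (Fin n) → ℂ) (hf : AnalyticOnNhd ℂ f Set.univ)
    (ha : ∀ z, f z ≠ a)
    (hb : ∀ α : EuclideanSpace ℂ (Fin n), f α = b → ∀ j, pd f j α = 0) :
    ∀ z w, f z = f w := by
  intro z w
  have hfd : Differentiable ℂ f := fun x => (hf x (Set.mem_univ x)).differentiableAt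
  have hder : ∀ t : ℂ, HasDerivAt (fun t : ℂ => f (z + t • (w - z)))
      (fderiv ℂ f (z + t • (w - z)) (w - z)) t := by
    intro t
    have h1 : HasDerivAt (fun t : ℂ => z + t • (w - z)) (w - z) t := by
      simpa using ((hasDerivAt_id t).smul_const (w - z)).const_add z
    exact (hfd _).hasFDerivAt.comp_hasDerivAt t h1
  have := aux_one (fun t : ℂ => f (z + t • (w - z))) (fun t => (hder t).differentiableAt) a b hab
    (fun t => ha _) (by
      intro t ht
      rw [(hder t).deriv]
      have h0 : fderiv ℂ f (z + t • (w - z)) = 0 := by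
        apply ContinuousLinearMap.coe_injective
        apply (EuclideanSpace.basisFun (Fin n) ℂ).toBasis.ext
        intro j
        simpa [pd] using hb _ ht j
      rw [h0]; rfl) 0 1
  simpa using this
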